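/- For n spins, index basis states by X := Fin n → Fin 2 and, for a 2×2 complex matrix A and site i, let S_i^A be the matrix on ℂ^X with entries (S_i^A)_{x,y} = A_{x(i), y(i)} · ∏_{j ≠ i} [x(j) = y(j)]. With s^x := (1/2)·[[1,−1],[−1,1]] and s^z := [[0,0],[0,1]], set H₀ := Σ_i S_i^{s^x}, H₁ := Σ_i S_i^{s^z}, and H_θ := H₀·cos θ + H₁·sin θ. For each sign pattern ε : Fin n → {+,−}, define V_ε(θ) ∈ ℂ^X by V_ε(θ)(x) := ∏_i (v_{ε(i)}(θ))_{x(i)}, where v_+(θ) := (−cos θ, 1 + sin θ) and v_−(θ) := (cos θ, 1 − sin θ). Then for every θ, H_θ · V_ε(θ) = (1/2)·(n(cos θ + sin θ) + (n₊ − n₋)) · V_ε(θ), where n₊ := #{i : ε(i) = +} and n₋ := n − n₊. -/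

import Mathlib

open scoped Matrix

/-- `s^x = (1/2)(I − σ^x)` as a complex matrix. -/
noncomputable def sxC : Matrix (Fin 2) (Fin 2) ℂ := !![1/2, -1/2; -1/2, 1/2]

/-- `s^z = (1/2)(I − σ^z)` as a complex matrix. -/
noncomputable def szC : Matrix (Fin 2) (Fin 2) ℂ := !![0, 0; 0, 1]

/-- The operator `S_i^A` acting as `A` on site `i` and as the identity elsewhere:
`(S_i^A)_{x,y} = A_{x(i),y(i)} ∏_{j ≠ i} [x(j) = y(j)]`. -/
noncomputable def siteOp (n : ℕ) (A : Matrix (Fin 2) (Fin 2) ℂ) (i : Fin n) :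
    Matrix (Fin n → Fin 2) (Fin n → Fin 2) ℂ := fun x y =>
  A (x i) (y i) * ∏ j ∈ Finset.univ.filter (fun j => j ≠ i), (if x j = y j then (1:ℂ) else 0)

/-- The single-spin eigenvector `v_±(θ)`, encoded with a sign `e = ±1` as
`v_e(θ) = (−e cos θ, 1 + e sin θ)`, viewed in `ℂ²`. -/
noncomputable def spinVec (e θ : ℝ) : Fin 2 → ℂ :=
  ![((-(e * Real.cos θ) : ℝ) : ℂ), ((1 + e * Real.sin θ : ℝ) : ℂ)]

/-- The sign `+1` or `−1` attached to a Boolean sign pattern entry. -/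
def signVal (b : Bool) : ℝ := if b then 1 else -1

/-- The tensor-product eigenvector `V_ε(θ)(x) = ∏_i (v_{ε(i)}(θ))_{x(i)}`. -/
noncomputable def bigVec (n : ℕ) (ε : Fin n → Bool) (θ : ℝ) : (Fin n → Fin 2) → ℂ :=
  fun x => ∏ i, spinVec (signVal (ε i)) θ (x i)

theorem siteOp_mulVec_prod (n : ℕ) (A : Matrix (Fin 2) (Fin 2) ℂ) (i : Fin n)
    (f : Fin n → Fin 2 → ℂ) (x : Fin n → Fin 2) :
    (siteOp n A i).mulVec (fun y => ∏ j, f j (y j)) x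
      = (∑ b, A (x i) b * f i b) * ∏ j ∈ Finset.univ.erase i, f j (x j) := by
  have key : ∀ y : Fin n → Fin 2, siteOp n A i x y * ∏ j, f j (y j) =
      ∏ j, (if j = i then A (x i) (y j) * f i (y j)
        else if x j = y j then f j (y j) else 0) := by
    intro y
    rw [← Finset.mul_prod_erase Finset.univ (fun j => (if j = i then A (x i) (y j) * f i (y j)
        else if x j = y j then f j (y j) else 0)) (Finset.mem_univ i),
      ← Finset.mul_prod_erase Finset.univ (fun j => f j (y j)) (Finset.mem_univ i)]
    have h1 : ∏ j ∈ Finset.univ.erase i, (if j = i then A (x i) (y j) * f i (y j)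
        else if x j = y j then f j (y j) else 0) =
        ∏ j ∈ Finset.univ.erase i, ((if x j = y j then (1:ℂ) else 0) * f j (y j)) := by
      refine Finset.prod_congr rfl fun j hj => ?_
      rw [if_neg (Finset.ne_of_mem_erase hj)]
      split_ifs <;> simp
    rw [h1, Finset.prod_mul_distrib, siteOp, Finset.filter_ne' Finset.univ i]
    simp only [if_true]
    ring
  simp only [Matrix.mulVec, dotProduct]
  rw [Finset.sum_congr rfl (fun y _ => key y)]
  have h2 := Finset.prod_univ_sum (fun _ : Fin n => (Finset.univ : Finset (Fin 2)))
    (fun j b => (if j = i then A (x i) b * f i b else if x j = b then f j b else 0))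
  rw [Fintype.piFinset_univ] at h2
  rw [← h2, ← Finset.mul_prod_erase Finset.univ _ (Finset.mem_univ i)]
  congr 1
  · simp
  · refine Finset.prod_congr rfl fun j hj => ?_
    simp [Finset.ne_of_mem_erase hj]

theorem single_spin (b : Bool) (θ : ℝ) (a : Fin 2) :
    (Real.cos θ : ℂ) * (∑ c, sxC a c * spinVec (signVal b) θ c)
      + (Real.sin θ : ℂ) * (∑ c, szC a c * spinVec (signVal b) θ c)
      = (((1 / 2 * (Real.cos θ + Real.sin θ + signVal b) : ℝ)) : ℂ) *
        spinVec (signVal b) θ a := by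
  have h : (Real.sin θ : ℂ) ^ 2 + (Real.cos θ : ℂ) ^ 2 = 1 := by
    exact_mod_cast Real.sin_sq_add_cos_sq θ
  fin_cases a <;> cases b <;>
    simp [sxC, szC, spinVec, signVal, Fin.sum_univ_two, -Complex.ofReal_sin,
      -Complex.ofReal_cos] at h ⊢
  all_goals grind

theorem sum_sign (n : ℕ) (ε : Fin n → Bool) :
    ∑ i, signVal (ε i) = ((Finset.univ.filter (fun i => ε i = true)).card : ℝ) -
              ((n - (Finset.univ.filter (fun i => ε i = true)).card : ℕ) : ℝ) := by
  have hle : (Finset.univ.filter (fun i => ε i = true)).card ≤ n := by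
    simpa using Finset.card_le_univ (Finset.univ.filter (fun i => ε i = true))
  rw [Nat.cast_sub hle]
  have : ∀ i, signVal (ε i) = 2 * (if ε i = true then (1:ℝ) else 0) - 1 := by
    intro i
    unfold signVal
    split_ifs <;> norm_num
  simp only [this, Finset.sum_sub_distrib, ← Finset.mul_sum, Finset.sum_boole]
  simp
  ring

/-- Along the trigonometric schedule from the transverse field `H₀ = Σᵢ Sᵢ^{sˣ}` to the
Hamming-weight Hamiltonian `H₁ = Σᵢ Sᵢ^{sᶻ}`, each tensor-product vector `V_ε(θ)` is an
eigenvector of `H_θ = H₀ cos θ + H₁ sin θ` with eigenvalue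
`(1/2)(n(cos θ + sin θ) + (n₊ − n₋))`. -/
theorem hamming_weight_energy_levels (n : ℕ) (θ : ℝ) (ε : Fin n → Bool) :
    ((Real.cos θ : ℂ) • (∑ i, siteOp n sxC i) + (Real.sin θ : ℂ) • (∑ i, siteOp n szC i)).mulVec
        (bigVec n ε θ)
      = (((1 / 2 * ((n : ℝ) * (Real.cos θ + Real.sin θ) +
            (((Finset.univ.filter (fun i => ε i = true)).card : ℝ) -
              ((n - (Finset.univ.filter (fun i => ε i = true)).card : ℕ) : ℝ))) : ℝ)) : ℂ) •
          bigVec n ε θ := by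
  rw [← sum_sign]
  have hE : (1 / 2 * ((n : ℝ) * (Real.cos θ + Real.sin θ) + ∑ i, signVal (ε i)))
      = ∑ i, (1 / 2 * (Real.cos θ + Real.sin θ + signVal (ε i))) := by
    rw [← Finset.mul_sum, Finset.sum_add_distrib]
    simp
    ring
  rw [hE]
  funext x
  rw [Matrix.add_mulVec, Matrix.smul_mulVec, Matrix.smul_mulVec, Matrix.sum_mulVec,
    Matrix.sum_mulVec]
  simp only [Pi.add_apply, Pi.smul_apply, Finset.sum_apply, smul_eq_mul, Complex.ofReal_sum]
  rw [Finset.mul_sum, Finset.mul_sum, ← Finset.sum_add_distrib, Finset.sum_mul]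
  refine Finset.sum_congr rfl fun i _ => ?_
  unfold bigVec
  rw [siteOp_mulVec_prod n sxC i (fun j => spinVec (signVal (ε j)) θ),
    siteOp_mulVec_prod n szC i (fun j => spinVec (signVal (ε j)) θ),
    ← Finset.mul_prod_erase Finset.univ (fun j => spinVec (signVal (ε j)) θ (x j))
      (Finset.mem_univ i), ← mul_assoc, ← mul_assoc, ← add_mul, single_spin, mul_assoc]
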